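/- (Counting the atoms below a basic conditional.) Let A ⊆ B ⊆ Ω be events with B nonempty. Then the number of enumerations σ of Ω whose σ-first element of B lies in A satisfies |⟦A∣B⟧| · |B| = n! · |A|; equivalently, |⟦A∣B⟧| = n! · |A| / |B|. -/

import Mathlib

open Finset

variable {Ω : Type*}

noncomputable def sigmaFirst [Fintype Ω] [DecidableEq Ω] [Nonempty Ω]
    (σ : Fin (Fintype.card Ω) ≃ Ω) (B : Finset Ω) : Ω :=
  if h : (Finset.univ.filter fun i => σ i ∈ B).Nonempty then
    σ ((Finset.univ.filter fun i => σ i ∈ B).min' h)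
  else Classical.arbitrary Ω

def condEvent [Fintype Ω] [DecidableEq Ω] [Nonempty Ω]
    (A B : Finset Ω) : Set (Fin (Fintype.card Ω) ≃ Ω) :=
  {σ | sigmaFirst σ B ∈ A}

theorem sigmaFirst_mem [Fintype Ω] [DecidableEq Ω] [Nonempty Ω]
    (σ : Fin (Fintype.card Ω) ≃ Ω) {B : Finset Ω} (hB : B.Nonempty) : sigmaFirst σ B ∈ B := by
  obtain ⟨b, hb⟩ := hB
  have h : (Finset.univ.filter fun i => σ i ∈ B).Nonempty := ⟨σ.symm b, by simpa using hb⟩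
  rw [sigmaFirst, dif_pos h]
  exact (Finset.mem_filter.mp (Finset.min'_mem _ h)).2

theorem sigmaFirst_trans [Fintype Ω] [DecidableEq Ω] [Nonempty Ω]
    (σ : Fin (Fintype.card Ω) ≃ Ω) {B : Finset Ω} (hB : B.Nonempty) (π : Equiv.Perm Ω)
    (hπ : ∀ x, π x ∈ B ↔ x ∈ B) : sigmaFirst (σ.trans π) B = π (sigmaFirst σ B) := by
  obtain ⟨b, hb⟩ := hB
  have h : (Finset.univ.filter fun i => σ i ∈ B).Nonempty := ⟨σ.symm b, by simpa using hb⟩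
  simp only [sigmaFirst, Equiv.trans_apply, hπ, dif_pos h]

theorem card_sigmaFirst_eq_congr [Fintype Ω] [DecidableEq Ω] [Nonempty Ω]
    {B : Finset Ω} {b c : Ω} (hb : b ∈ B) (hc : c ∈ B) :
    (Finset.univ.filter fun σ : Fin (Fintype.card Ω) ≃ Ω => sigmaFirst σ B = b).card =
      (Finset.univ.filter fun σ : Fin (Fintype.card Ω) ≃ Ω => sigmaFirst σ B = c).card := by
  have hπ : ∀ x, Equiv.swap b c x ∈ B ↔ x ∈ B := by
    intro x
    rw [Equiv.swap_apply_def]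
    split_ifs <;> simp_all
  refine Finset.card_equiv (Equiv.equivCongr (Equiv.refl _) (Equiv.swap b c)) fun σ => ?_
  have hσ : Equiv.equivCongr (Equiv.refl _) (Equiv.swap b c) σ = σ.trans (Equiv.swap b c) := by
    ext; simp
  rw [hσ, Finset.mem_filter, Finset.mem_filter, sigmaFirst_trans σ ⟨b, hb⟩ _ hπ]
  simp [Equiv.swap_apply_eq_iff]

theorem ncard_condEvent [Fintype Ω] [DecidableEq Ω] [Nonempty Ω]
    {A B : Finset Ω} (hAB : A ⊆ B) {b : Ω} (hb : b ∈ B) :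
    (condEvent A B).ncard = A.card *
      (Finset.univ.filter fun σ : Fin (Fintype.card Ω) ≃ Ω => sigmaFirst σ B = b).card := by
  have h : condEvent A B =
      ((Finset.univ.filter fun σ : Fin (Fintype.card Ω) ≃ Ω => sigmaFirst σ B ∈ A : Finset _) :
        Set (Fin (Fintype.card Ω) ≃ Ω)) := by
    ext; simp [condEvent]
  rw [h, Set.ncard_coe_finset,
    Finset.card_eq_sum_card_fiberwise (f := fun σ => sigmaFirst σ B) (t := A)
      (fun σ hσ => by simpa using hσ)]
  refine Finset.sum_const_nat fun a ha => ?_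
  rw [← card_sigmaFirst_eq_congr (hAB ha) hb, Finset.filter_filter]
  congr 1
  ext σ
  simp only [Finset.mem_filter, Finset.mem_univ, true_and, and_iff_right_iff_imp]
  rintro rfl
  exact ha

theorem ncard_condEvent_self [Fintype Ω] [DecidableEq Ω] [Nonempty Ω]
    {B : Finset Ω} (hB : B.Nonempty) :
    (condEvent B B).ncard = Nat.factorial (Fintype.card Ω) := by
  have h : condEvent B B = Set.univ := Set.eq_univ_of_forall fun σ => sigmaFirst_mem σ hB
  rw [h, Set.ncard_univ, Nat.card_eq_fintype_card,
    Fintype.card_equiv (Fintype.equivFin Ω).symm, Fintype.card_fin]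

theorem stmt7 [Fintype Ω] [DecidableEq Ω] [Nonempty Ω]
    (A B : Finset Ω) (hAB : A ⊆ B) (hB : B.Nonempty) :
    (condEvent A B).ncard * B.card = Nat.factorial (Fintype.card Ω) * A.card ∧
    (condEvent A B).ncard = Nat.factorial (Fintype.card Ω) * A.card / B.card := by
  have key : (condEvent A B).ncard * B.card = Nat.factorial (Fintype.card Ω) * A.card := by
    obtain ⟨b, hb⟩ := hB
    rw [← ncard_condEvent_self ⟨b, hb⟩, ncard_condEvent hAB hb,
      ncard_condEvent (Finset.Subset.refl B) hb]
    ring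
  exact ⟨key, (Nat.div_eq_of_eq_mul_left hB.card_pos key.symm).symm⟩
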